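/- (i) H∞[4] acts transitively on Σ[4]: for any x, y ∈ Σ[4] there exists w ∈ H∞[4] with w(x) = y. (ii) H∞[3] acts transitively on Σ[3]. -/

import Mathlib

noncomputable section

/-- The golden ratio τ = (1+√5)/2. -/
def gr : ℝ := (1 + Real.sqrt 5) / 2

/-- ℛ = ℤ[1/2, τ], the ring of dyadic golden numbers, as a subset of ℝ. -/
def Rgold : Set ℝ := {x : ℝ | ∃ (a b : ℤ) (n : ℕ), x = ((a : ℝ) + (b : ℝ) * gr) / 2 ^ n}

/-- The H₄ root system with parameter t (t = τ gives Δ[4], t = 1-τ = τ' gives Δ[4]'). -/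
def DeltaSet (t : ℝ) : Set (Fin 4 → ℝ) :=
  {x | (∃ i, (x i = 1 ∨ x i = -1) ∧ ∀ j, j ≠ i → x j = 0)
    ∨ (∀ i, x i = 1/2 ∨ x i = -1/2)
    ∨ (∃ σ : Equiv.Perm (Fin 4), Equiv.Perm.sign σ = 1 ∧
        ∃ ε : Fin 4 → ℝ, (∀ i, ε i = 1 ∨ ε i = -1) ∧
          ∀ i, x i = ε i * (![0, 1, 1 - t, t] (σ i)) / 2)}

/-- The H₃ root system with parameter t (t = τ gives Δ[3], t = 1-τ = τ' gives Δ[3]'):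
the 6 vectors (±1,0,0) and permutations, and the 24 vectors obtained from
½(±1,±τ',±τ) by cyclic (= even) permutations of the coordinates. -/
def Delta3 (t : ℝ) : Set (Fin 3 → ℝ) :=
  {x | (∃ i, (x i = 1 ∨ x i = -1) ∧ ∀ j, j ≠ i → x j = 0)
    ∨ (∃ σ : Equiv.Perm (Fin 3), Equiv.Perm.sign σ = 1 ∧
        ∃ ε : Fin 3 → ℝ, (∀ i, ε i = 1 ∨ ε i = -1) ∧
          ∀ i, x i = ε i * (![1, 1 - t, t] (σ i)) / 2)}

/-- The matrix of the reflection `x ↦ x - 2(x·a)a` in the standard basis (dimension 4). -/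
def reflMat (a : Fin 4 → ℝ) : Matrix (Fin 4) (Fin 4) ℝ :=
  Matrix.of fun i j => (if i = j then (1 : ℝ) else 0) - 2 * a i * a j

/-- The matrix of the reflection `x ↦ x - 2(x·a)a` in the standard basis (dimension 3). -/
def reflMat3 (a : Fin 3 → ℝ) : Matrix (Fin 3) (Fin 3) ℝ :=
  Matrix.of fun i j => (if i = j then (1 : ℝ) else 0) - 2 * a i * a j

/-- H∞[4], the subgroup of O(4,ℝ) generated by the reflections in the roots of Δ[4] ∪ Δ[4]'. -/
def HinfG : Subgroup (Matrix.orthogonalGroup (Fin 4) ℝ) :=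
  Subgroup.closure {g | ∃ a ∈ DeltaSet gr ∪ DeltaSet (1 - gr),
    (g : Matrix (Fin 4) (Fin 4) ℝ) = reflMat a}

/-- H∞[3], the subgroup of O(3,ℝ) generated by the reflections in the roots of Δ[3] ∪ Δ[3]'. -/
def HinfG3 : Subgroup (Matrix.orthogonalGroup (Fin 3) ℝ) :=
  Subgroup.closure {g | ∃ a ∈ Delta3 gr ∪ Delta3 (1 - gr),
    (g : Matrix (Fin 3) (Fin 3) ℝ) = reflMat3 a}

/-- Σ[4], the orbit of Δ[4] ∪ Δ[4]' under H∞[4]. -/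
def SigmaSet : Set (Fin 4 → ℝ) :=
  {x | ∃ g ∈ HinfG, ∃ a ∈ DeltaSet gr ∪ DeltaSet (1 - gr),
    x = Matrix.mulVec (g : Matrix (Fin 4) (Fin 4) ℝ) a}

/-- Σ[3], the orbit of Δ[3] ∪ Δ[3]' under H∞[3]. -/
def SigmaSet3 : Set (Fin 3 → ℝ) :=
  {x | ∃ g ∈ HinfG3, ∃ a ∈ Delta3 gr ∪ Delta3 (1 - gr),
    x = Matrix.mulVec (g : Matrix (Fin 3) (Fin 3) ℝ) a}


section OrbitRelation

variable {n : Type*} [Fintype n] [DecidableEq n]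

/-- `y` lies in the orbit of `x` under the subgroup `G` of the orthogonal group. -/
def OrbRel (G : Subgroup (Matrix.orthogonalGroup n ℝ)) (x y : n → ℝ) : Prop :=
  ∃ g ∈ G, Matrix.mulVec (g : Matrix n n ℝ) x = y

/-- `a` is a unit vector whose reflection belongs to `G`. -/
def IsRootOf (G : Subgroup (Matrix.orthogonalGroup n ℝ)) (a : n → ℝ) : Prop :=
  a ⬝ᵥ a = 1 ∧ ∃ g ∈ G, ∀ x, Matrix.mulVec (g : Matrix n n ℝ) x = x - (2 * (a ⬝ᵥ x)) • a

variable {G : Subgroup (Matrix.orthogonalGroup n ℝ)} {x y z a b : n → ℝ}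

lemma OrbRel.refl (x : n → ℝ) : OrbRel G x x :=
  ⟨1, one_mem _, by rw [Submonoid.coe_one, Matrix.one_mulVec]⟩

lemma OrbRel.symm (h : OrbRel G x y) : OrbRel G y x := by
  obtain ⟨g, hg, rfl⟩ := h
  refine ⟨g⁻¹, inv_mem hg, ?_⟩
  rw [Matrix.mulVec_mulVec, ← Submonoid.coe_mul, inv_mul_cancel, Submonoid.coe_one,
    Matrix.one_mulVec]

lemma OrbRel.trans (h : OrbRel G x y) (h' : OrbRel G y z) : OrbRel G x z := by
  obtain ⟨g, hg, rfl⟩ := h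
  obtain ⟨k, hk, rfl⟩ := h'
  exact ⟨k * g, mul_mem hk hg, by rw [Matrix.mulVec_mulVec, ← Submonoid.coe_mul]⟩

lemma IsRootOf.orbRel_reflection (ha : IsRootOf G a) (x : n → ℝ) :
    OrbRel G x (x - (2 * (a ⬝ᵥ x)) • a) := by
  obtain ⟨-, g, hg, h⟩ := ha
  exact ⟨g, hg, h x⟩

lemma IsRootOf.orbRel_neg (ha : IsRootOf G a) : OrbRel G a (-a) := by
  have h := ha.orbRel_reflection a
  rw [ha.1] at h
  convert h using 1
  module

/-- Roots at angle `π / 3` or `2 * π / 3` are conjugate. -/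
lemma IsRootOf.orbRel_of_dotProduct (ha : IsRootOf G a) (hb : IsRootOf G b)
    (h : a ⬝ᵥ b = 1 / 2 ∨ a ⬝ᵥ b = -1 / 2) : OrbRel G a b := by
  have h1 := hb.orbRel_reflection a
  have h2 := ha.orbRel_reflection (a - (2 * (b ⬝ᵥ a)) • b)
  rw [dotProduct_comm b a, dotProduct_sub, dotProduct_smul, ha.1] at *
  rcases h with h | h <;> rw [h] at h1 h2
  · refine (h1.trans h2).trans ?_
    convert hb.orbRel_neg.symm using 1
    simp only [smul_eq_mul]
    module
  · refine (h1.trans h2).trans ?_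
    convert OrbRel.refl b using 1
    simp only [smul_eq_mul]
    module

/-- If all roots in `S` are conjugate to `b`, then the orbit of `S` is a single orbit. -/
lemma orbRel_of_orbit {S : Set (n → ℝ)} (hS : ∀ a ∈ S, OrbRel G b a)
    (hx : ∃ g ∈ G, ∃ a ∈ S, x = Matrix.mulVec (g : Matrix n n ℝ) a)
    (hy : ∃ g ∈ G, ∃ a ∈ S, y = Matrix.mulVec (g : Matrix n n ℝ) a) : OrbRel G x y := by
  have key : ∀ z, (∃ g ∈ G, ∃ a ∈ S, z = Matrix.mulVec (g : Matrix n n ℝ) a) → OrbRel G b z := by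
    rintro z ⟨g, hg, a, ha, rfl⟩
    exact (hS a ha).trans ⟨g, hg, rfl⟩
  exact (key x hx).symm.trans (key y hy)

lemma reflection_mulVec (a x : n → ℝ) :
    Matrix.mulVec (Matrix.of fun i j => (if i = j then (1 : ℝ) else 0) - 2 * a i * a j) x
      = x - (2 * (a ⬝ᵥ x)) • a := by
  ext i
  simp only [Matrix.mulVec, dotProduct, Matrix.of_apply, sub_mul, Finset.sum_sub_distrib, ite_mul,
    one_mul, zero_mul, Finset.sum_ite_eq, Finset.mem_univ, if_true, Pi.sub_apply, Pi.smul_apply,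
    smul_eq_mul, Finset.mul_sum, Finset.sum_mul]
  congr 1
  exact Finset.sum_congr rfl fun j _ => by ring

lemma reflection_mem_orthogonalGroup (ha : a ⬝ᵥ a = 1) :
    (Matrix.of fun i j => (if i = j then (1 : ℝ) else 0) - 2 * a i * a j)
      ∈ Matrix.orthogonalGroup n ℝ := by
  rw [Matrix.mem_orthogonalGroup_iff]
  have hs : (Matrix.of fun i j => (if i = j then (1 : ℝ) else 0) - 2 * a i * a j).transpose
      = Matrix.of fun i j => (if i = j then (1 : ℝ) else 0) - 2 * a i * a j := by
    ext i j
    simp only [Matrix.transpose_apply, Matrix.of_apply, eq_comm (a := j)]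
    ring
  rw [hs]
  refine Matrix.ext_of_mulVec_single fun i => ?_
  rw [← Matrix.mulVec_mulVec, reflection_mulVec, reflection_mulVec, Matrix.one_mulVec,
    dotProduct_sub, dotProduct_smul, ha]
  simp only [smul_eq_mul]
  module

/-- A vector with one coordinate `±1` and all others zero is `±` a standard basis vector. -/
lemma orbRel_of_eq_single (hroot : ∀ i, IsRootOf G (Pi.single i 1)) {i : n}
    (hi : x i = 1 ∨ x i = -1) (h0 : ∀ j, j ≠ i → x j = 0) : OrbRel G (Pi.single i 1) x := by
  have hx : x = Pi.single i (x i) := by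
    ext j
    by_cases h : j = i
    · subst h; simp
    · simp [h, h0 j h]
  rcases hi with hi | hi <;> rw [hi] at hx <;> rw [hx]
  · exact OrbRel.refl _
  · rw [Pi.single_neg]
    exact (hroot i).orbRel_neg

lemma orbRel_single_of_half {i : n} (hi : IsRootOf G (Pi.single i 1)) (hx : IsRootOf G x)
    (h : x i = 1 / 2 ∨ x i = -1 / 2) : OrbRel G (Pi.single i 1) x :=
  hi.orbRel_of_dotProduct hx (by simpa using h)

end OrbitRelation

lemma dotProduct_self_of_single {n : Type*} [Fintype n] {x : n → ℝ} {i : n} (hi : x i = 1 ∨ x i = -1) (h0 : ∀ j, j ≠ i → x j = 0) :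
    x ⬝ᵥ x = 1 := by
  rw [dotProduct, Finset.sum_eq_single i (fun j _ hj => by rw [h0 j hj, zero_mul]) (by simp)]
  rcases hi with hi | hi <;> rw [hi] <;> norm_num

lemma dotProduct_self_of_signed_perm {n : Type*} [Fintype n] {x v ε : n → ℝ}
    {σ : Equiv.Perm n} (hv : v ⬝ᵥ v = 4) (hε : ∀ i, ε i = 1 ∨ ε i = -1) (hx : ∀ i, x i = ε i * v (σ i) / 2) :
    x ⬝ᵥ x = 1 := by
  have h : ∀ i, x i * x i = (v (σ i) * v (σ i)) / 4 := fun i => by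
    rcases hε i with h | h <;> rw [hx, h] <;> ring
  rw [dotProduct, Finset.sum_congr rfl fun i _ => h i, ← Finset.sum_div,
    Equiv.sum_comp σ fun i => v i * v i]
  rw [dotProduct] at hv
  rw [hv]
  norm_num

lemma gr_sq : gr ^ 2 = gr + 1 := by
  have h : Real.sqrt 5 ^ 2 = 5 := Real.sq_sqrt (by norm_num)
  unfold gr
  linear_combination h / 4

lemma one_sub_gr_sq : (1 - gr) ^ 2 = (1 - gr) + 1 := by
  linear_combination gr_sq

lemma dotProduct_self_of_mem_deltaSet {t : ℝ} (ht : t ^ 2 = t + 1) {x : Fin 4 → ℝ}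
    (hx : x ∈ DeltaSet t) : x ⬝ᵥ x = 1 := by
  rcases hx with ⟨i, hi, h0⟩ | h | ⟨σ, -, ε, hε, h⟩
  · exact dotProduct_self_of_single hi h0
  · have h' : ∀ i, x i * x i = 1 / 4 := fun i => by
      rcases h i with h | h <;> rw [h] <;> norm_num
    simp [dotProduct, h']
  · refine dotProduct_self_of_signed_perm (v := ![0, 1, 1 - t, t]) ?_ hε h
    simp [dotProduct, Fin.sum_univ_four]
    linear_combination 2 * ht

lemma dotProduct_self_of_mem_delta3 {t : ℝ} (ht : t ^ 2 = t + 1) {x : Fin 3 → ℝ}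
    (hx : x ∈ Delta3 t) : x ⬝ᵥ x = 1 := by
  rcases hx with ⟨i, hi, h0⟩ | ⟨σ, -, ε, hε, h⟩
  · exact dotProduct_self_of_single hi h0
  · refine dotProduct_self_of_signed_perm (v := ![1, 1 - t, t]) ?_ hε h
    simp [dotProduct, Fin.sum_univ_three]
    linear_combination 2 * ht

lemma isRootOf_hinfG {x : Fin 4 → ℝ} (hx : x ∈ DeltaSet gr ∪ DeltaSet (1 - gr)) :
    IsRootOf HinfG x := by
  have h1 : x ⬝ᵥ x = 1 := hx.elim (dotProduct_self_of_mem_deltaSet gr_sq)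
    (dotProduct_self_of_mem_deltaSet one_sub_gr_sq)
  exact ⟨h1, ⟨_, reflection_mem_orthogonalGroup h1⟩, Subgroup.subset_closure ⟨x, hx, rfl⟩,
    reflection_mulVec x⟩

lemma isRootOf_hinfG3 {x : Fin 3 → ℝ} (hx : x ∈ Delta3 gr ∪ Delta3 (1 - gr)) :
    IsRootOf HinfG3 x := by
  have h1 : x ⬝ᵥ x = 1 := hx.elim (dotProduct_self_of_mem_delta3 gr_sq)
    (dotProduct_self_of_mem_delta3 one_sub_gr_sq)
  exact ⟨h1, ⟨_, reflection_mem_orthogonalGroup h1⟩, Subgroup.subset_closure ⟨x, hx, rfl⟩,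
    reflection_mulVec x⟩

lemma isRootOf_hinfG_single (i : Fin 4) : IsRootOf HinfG (Pi.single i 1) :=
  isRootOf_hinfG (.inl (.inl ⟨i, by simp, fun j hj => by simp [hj]⟩))

lemma isRootOf_hinfG3_single (i : Fin 3) : IsRootOf HinfG3 (Pi.single i 1) :=
  isRootOf_hinfG3 (.inl (.inl ⟨i, by simp, fun j hj => by simp [hj]⟩))

lemma orbRel_hinfG_single (i : Fin 4) : OrbRel HinfG (Pi.single 0 1) (Pi.single i 1) := by
  have hh : IsRootOf HinfG (fun _ => 1 / 2) := isRootOf_hinfG (.inl (.inr (.inl fun _ => .inl rfl)))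
  exact (orbRel_single_of_half (isRootOf_hinfG_single 0) hh (.inl rfl)).trans
    (orbRel_single_of_half (isRootOf_hinfG_single i) hh (.inl rfl)).symm

/-- Consecutive basis vectors are joined by a chain of roots at mutual angles `π / 3`. -/
lemma orbRel_hinfG3_single_succ (i : Fin 3) :
    OrbRel HinfG3 (Pi.single i 1) (Pi.single (i + 1) 1) := by
  let v : Fin 3 → ℝ := fun j => 1 * ![1, 1 - gr, gr] (Equiv.subRight i j) / 2
  let w : Fin 3 → ℝ := fun j =>
    ![1, 1, -1] (Equiv.subRight i j) * ![1, 1 - gr, gr] (Equiv.subRight (i + 1) j) / 2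
  have hsign : ∀ i : Fin 3, Equiv.Perm.sign (Equiv.subRight i) = 1 := by decide
  have hε : ∀ k : Fin 3, (![1, 1, -1] k : ℝ) = 1 ∨ (![1, 1, -1] k : ℝ) = -1 := by
    intro k
    fin_cases k <;> simp
  have hv : IsRootOf HinfG3 v :=
    isRootOf_hinfG3 (.inl (.inr ⟨_, hsign i, fun _ => 1, fun _ => .inl rfl, fun _ => rfl⟩))
  have hw : IsRootOf HinfG3 w :=
    isRootOf_hinfG3 (.inl (.inr ⟨_, hsign (i + 1), fun j => ![1, 1, -1] (Equiv.subRight i j),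
      fun j => hε _, fun _ => rfl⟩))
  have hvw : v ⬝ᵥ w = 1 / 2 := by
    have hg := gr_sq
    fin_cases i <;> simp [v, w, dotProduct, Fin.sum_univ_three] <;> linear_combination hg / 4
  exact ((orbRel_single_of_half (isRootOf_hinfG3_single i) hv (.inl (by simp [v]))).trans
    (hv.orbRel_of_dotProduct hw (.inl hvw))).trans
    (orbRel_single_of_half (isRootOf_hinfG3_single (i + 1)) hw (.inl (by simp [w]))).symm

lemma orbRel_hinfG3_single (i : Fin 3) : OrbRel HinfG3 (Pi.single 0 1) (Pi.single i 1) := by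
  have h0 := orbRel_hinfG3_single_succ 0
  have h1 := orbRel_hinfG3_single_succ 1
  have h2 := orbRel_hinfG3_single_succ 2
  fin_cases i
  exacts [(h0.trans h1).trans h2, h0, h0.trans h1]

lemma orbRel_hinfG_of_root {x : Fin 4 → ℝ} (hx : x ∈ DeltaSet gr ∪ DeltaSet (1 - gr)) :
    OrbRel HinfG (Pi.single 0 1) x := by
  have hroot := isRootOf_hinfG hx
  have key : ∀ t, x ∈ DeltaSet t → OrbRel HinfG (Pi.single 0 1) x := by
    rintro t (⟨i, hi, h0⟩ | h | ⟨σ, -, ε, hε, h⟩)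
    · exact (orbRel_hinfG_single i).trans (orbRel_of_eq_single isRootOf_hinfG_single hi h0)
    · exact orbRel_single_of_half (isRootOf_hinfG_single 0) hroot (h 0)
    · refine (orbRel_hinfG_single (σ.symm 1)).trans
        (orbRel_single_of_half (isRootOf_hinfG_single _) hroot ?_)
      rcases hε (σ.symm 1) with h' | h' <;> simp [h, h']
  exact hx.elim (key _) (key _)

lemma orbRel_hinfG3_of_root {x : Fin 3 → ℝ} (hx : x ∈ Delta3 gr ∪ Delta3 (1 - gr)) :
    OrbRel HinfG3 (Pi.single 0 1) x := by
  have hroot := isRootOf_hinfG3 hx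
  have key : ∀ t, x ∈ Delta3 t → OrbRel HinfG3 (Pi.single 0 1) x := by
    rintro t (⟨i, hi, h0⟩ | ⟨σ, -, ε, hε, h⟩)
    · exact (orbRel_hinfG3_single i).trans (orbRel_of_eq_single isRootOf_hinfG3_single hi h0)
    · refine (orbRel_hinfG3_single (σ.symm 0)).trans
        (orbRel_single_of_half (isRootOf_hinfG3_single _) hroot ?_)
      rcases hε (σ.symm 0) with h' | h' <;> simp [h, h']
  exact hx.elim (key _) (key _)

theorem statement13 :
    (∀ x ∈ SigmaSet, ∀ y ∈ SigmaSet, ∃ g ∈ HinfG,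
        Matrix.mulVec (g : Matrix (Fin 4) (Fin 4) ℝ) x = y) ∧
    (∀ x ∈ SigmaSet3, ∀ y ∈ SigmaSet3, ∃ g ∈ HinfG3,
        Matrix.mulVec (g : Matrix (Fin 3) (Fin 3) ℝ) x = y) := by
  exact ⟨fun _ hx _ hy => orbRel_of_orbit (fun _ => orbRel_hinfG_of_root) hx hy,
    fun _ hx _ hy => orbRel_of_orbit (fun _ => orbRel_hinfG3_of_root) hx hy⟩
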